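/- arXiv:1001.1438 — 8 statements merged into one kernel-verified Lean document; each statement's English description precedes it below -/
import Mathlib

section
/- Consider Cournot oligopoly data with a Nash equilibrium q* ∈ S, and suppose conditions (2.15) hold. Let 0 ≤ Θ < 1, 0 < r ≤ T, and let θ_i : [0,∞) → [0,Θ], τ_i : [0,∞) → [r,T], d_{i,j} : [0,∞) → [−1,1] (i ≠ j, i,j = 1,…,n) be arbitrary functions. Let q : [−T,∞) → S be a bounded function satisfying, for all t ≥ 0 and all i, q_i(t) = θ_i(t)·min{Q_i, max{0, q_i(t−τ_i(t))}} + (1−θ_i(t))·min{Q_i, max{0, (ab−c_i)/(2b+K_i) − R_i·Σ_{j≠i} min{Q_j, max{0, q_j* + d_{i,j}(t)·‖q_j−q_j*‖_{[t−T,t−r]}}}}}. Then lim_{t→∞} q(t) = q*; moreover, for every ε > 0 there exists δ > 0 such that every such function q (for any admissible θ_i, τ_i, d_{i,j}) with ‖q − q*‖_{[−T,0]} ≤ δ satisfies |q(t) − q*| ≤ ε for all t ≥ 0. -/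
open scoped BigOperators

/-- Euclidean norm of a vector in ℝ^m. -/
noncomputable def eNorm {m : ℕ} (v : Fin m → ℝ) : ℝ := Real.sqrt (∑ i, (v i) ^ 2)

/-- Sup norm of a scalar signal over the interval [α, β]. -/
noncomputable def sNorm (x : ℝ → ℝ) (α β : ℝ) : ℝ := sSup ((fun τ => |x τ|) '' Set.Icc α β)

/-- Sup (over [α, β]) of the Euclidean norm of a vector-valued signal. -/
noncomputable def vNorm {m : ℕ} (x : ℝ → Fin m → ℝ) (α β : ℝ) : ℝ :=
  sSup ((fun τ => eNorm (x τ)) '' Set.Icc α β)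

/-- Admissible uncertain dynamics for the Cournot functional difference equation (2.10):
`θ i t ∈ [0,Θ]`, `τ i t ∈ [r,T]`, `d i j t ∈ [-1,1]`, the trajectory takes values in
`S = Π [0, Q i]`, and the functional difference equation holds for all `t ≥ 0`. -/
def CournotAdmissible (n : ℕ) (a b : ℝ) (Q c K R qstar : Fin n → ℝ) (Θ r T : ℝ)
    (θ τ : Fin n → ℝ → ℝ) (d : Fin n → Fin n → ℝ → ℝ) (q : ℝ → Fin n → ℝ) : Prop :=
  (∀ i t, 0 ≤ t → θ i t ∈ Set.Icc 0 Θ) ∧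
  (∀ i t, 0 ≤ t → τ i t ∈ Set.Icc r T) ∧
  (∀ i j t, i ≠ j → 0 ≤ t → d i j t ∈ Set.Icc (-1 : ℝ) 1) ∧
  (∀ t, -T ≤ t → ∀ i, q t i ∈ Set.Icc 0 (Q i)) ∧
  (∀ t, 0 ≤ t → ∀ i, q t i =
      θ i t * min (Q i) (max 0 (q (t - τ i t) i)) +
      (1 - θ i t) * min (Q i) (max 0 ((a * b - c i) / (2 * b + K i) -
        R i * ∑ j ∈ Finset.univ.erase i,
          min (Q j) (max 0 (qstar j +
            d i j t * sNorm (fun s => q s j - qstar j) (t - T) (t - r))))))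

open Filter Topology

lemma eNorm_le_sum_abs {m : ℕ} (v : Fin m → ℝ) : eNorm v ≤ ∑ i, |v i| := by
  refine Real.sqrt_le_iff.2 ⟨Finset.sum_nonneg fun i _ => abs_nonneg _, ?_⟩
  simpa using Finset.sum_sq_le_sq_sum_of_nonneg (s := Finset.univ) (f := fun i => |v i|)
    fun i _ => abs_nonneg (v i)

lemma abs_apply_le_eNorm {m : ℕ} (v : Fin m → ℝ) (i : Fin m) : |v i| ≤ eNorm v := by
  refine Real.abs_le_sqrt ?_
  exact Finset.single_le_sum (f := fun i => v i ^ 2) (fun j _ => sq_nonneg (v j))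
    (Finset.mem_univ i)

lemma abs_clamp_sub_clamp_le (c x y : ℝ) :
    |min c (max 0 x) - min c (max 0 y)| ≤ |x - y| :=
  (abs_min_sub_min_le_max c _ c _).trans (by
    simpa using (abs_max_sub_max_le_max 0 x 0 y))

/-- The cyclic small-gain conditions on pairs already yield a weighted sup-norm in which the
interaction is a strict contraction. -/
lemma exists_contraction_weights {n : ℕ} (hn : 2 ≤ n) (R : Fin n → ℝ) (hR : ∀ i, 0 < R i)
    (hpair : ∀ i j, i ≠ j → R i * R j * ((n : ℝ) - 1) ^ 2 < 1) :
    ∃ w : Fin n → ℝ, ∃ ρ : ℝ, (∀ i, 1 ≤ w i) ∧ 0 ≤ ρ ∧ ρ < 1 ∧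
      ∀ i, R i * ∑ j ∈ Finset.univ.erase i, w j ≤ ρ * w i := by
  have hn1 : (0 : ℝ) < (n : ℝ) - 1 := by
    have : (2 : ℝ) ≤ n := by exact_mod_cast hn
    linarith
  have hsum : ∀ (w : Fin n → ℝ) (M : ℝ) (i : Fin n), (∀ j, j ≠ i → w j ≤ M) →
      R i * ∑ j ∈ Finset.univ.erase i, w j ≤ R i * ((n : ℝ) - 1) * M := by
    intro w M i h
    have h1 := Finset.sum_le_card_nsmul (Finset.univ.erase i) w M
      (fun j hj => h j (Finset.ne_of_mem_erase hj))
    rw [Finset.card_erase_of_mem (Finset.mem_univ i), Finset.card_univ, Fintype.card_fin,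
      nsmul_eq_mul, Nat.cast_sub (by omega), Nat.cast_one] at h1
    rw [mul_assoc]
    exact mul_le_mul_of_nonneg_left h1 (hR i).le
  have key : ∃ w : Fin n → ℝ, (∀ i, 1 ≤ w i) ∧
      ∀ i, R i * ∑ j ∈ Finset.univ.erase i, w j < w i := by
    by_cases hall : ∀ i, R i * ((n : ℝ) - 1) < 1
    · refine ⟨fun _ => 1, fun _ => le_rfl, fun i => ?_⟩
      have := hsum (fun _ => 1) 1 i (fun _ _ => le_rfl)
      linarith [hall i]
    · push Not at hall
      obtain ⟨k, hk⟩ := hall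
      have hev : ∀ᶠ m in 𝓝[>] (R k * ((n : ℝ) - 1)),
          ∀ j, j ≠ k → R j * ((n : ℝ) - 1) * m < 1 := by
        refine nhdsWithin_le_nhds (eventually_all.2 fun j => ?_)
        by_cases hjk : j = k
        · exact Eventually.of_forall fun m h => absurd hjk h
        · have hc : Continuous fun m : ℝ => R j * ((n : ℝ) - 1) * m := by fun_prop
          filter_upwards [hc.continuousAt.eventually_lt continuousAt_const
            (by linarith [hpair j k hjk] :
              R j * ((n : ℝ) - 1) * (R k * ((n : ℝ) - 1)) < 1)] with m hm _ using hm
      obtain ⟨m, hm, hkm⟩ := (hev.and self_mem_nhdsWithin).exists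
      have hkm : R k * ((n : ℝ) - 1) < m := hkm
      refine ⟨fun i => if i = k then m else 1, fun i => ?_, fun i => ?_⟩
      · dsimp only
        split_ifs <;> linarith
      · by_cases hik : i = k
        · subst hik
          have := hsum (fun j => if j = i then m else 1) 1 i
            (fun j hj => by simp [hj])
          simp only [if_true]
          linarith
        · have := hsum (fun j => if j = k then m else 1) m i
            (fun j _ => by split_ifs <;> linarith)
          simp only [hik, if_false]
          linarith [hm i hik]
  obtain ⟨w, hw1, hw⟩ := key
  have hev : ∀ᶠ ρ in 𝓝[<] (1 : ℝ), ∀ i, R i * ∑ j ∈ Finset.univ.erase i, w j < ρ * w i := by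
    refine nhdsWithin_le_nhds (eventually_all.2 fun i => ?_)
    have hc : Continuous fun ρ : ℝ => ρ * w i := by fun_prop
    exact continuousAt_const.eventually_lt hc.continuousAt (by simpa using hw i)
  obtain ⟨ρ, hρ, hρ1⟩ := (hev.and self_mem_nhdsWithin).exists
  refine ⟨w, ρ, hw1, ?_, hρ1, fun i => (hρ i).le⟩
  have h0 : 0 ≤ R (⟨0, by omega⟩ : Fin n) * ∑ j ∈ Finset.univ.erase ⟨0, by omega⟩, w j :=
    mul_nonneg (hR _).le (Finset.sum_nonneg fun j _ => zero_le_one.trans (hw1 j))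
  have := h0.trans_lt (hρ ⟨0, by omega⟩)
  exact (pos_of_mul_pos_left this (zero_le_one.trans (hw1 _))).le

/-- One-step estimate: a weighted bound on the delay window `[t - T, t - r]` contracts at
time `t`. -/
lemma CournotAdmissible.abs_sub_le {n : ℕ} {a b : ℝ} {Q c K R qstar : Fin n → ℝ} {Θ r T : ℝ}
    {θ τ : Fin n → ℝ → ℝ} {d : Fin n → Fin n → ℝ → ℝ} {q : ℝ → Fin n → ℝ}
    (hq : CournotAdmissible n a b Q c K R qstar Θ r T θ τ d q)
    (hR : ∀ i, 0 < R i) (hqstarS : ∀ i, qstar i ∈ Set.Icc 0 (Q i))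
    (hNash : ∀ i, qstar i = min (Q i) (max 0 ((a * b - c i) / (2 * b + K i) -
      R i * ∑ j ∈ Finset.univ.erase i, qstar j)))
    (hΘ1 : Θ < 1) {w : Fin n → ℝ} {ρ : ℝ} (hw1 : ∀ i, 1 ≤ w i) (hρ1 : ρ < 1)
    (hw : ∀ i, R i * ∑ j ∈ Finset.univ.erase i, w j ≤ ρ * w i)
    {C : ℝ} (hC : 0 ≤ C) {t : ℝ} (ht : 0 ≤ t)
    (hwin : ∀ s ∈ Set.Icc (t - T) (t - r), ∀ i, |q s i - qstar i| ≤ C * w i) (i : Fin n) :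
    |q t i - qstar i| ≤ (Θ + (1 - Θ) * ρ) * C * w i := by
  obtain ⟨hθ, hτ, hd, -, heq⟩ := hq
  have hfix : ∀ j, min (Q j) (max 0 (qstar j)) = qstar j := fun j => by
    rw [max_eq_right (hqstarS j).1, min_eq_right (hqstarS j).2]
  have hw0 : ∀ j, 0 ≤ C * w j := fun j => mul_nonneg hC (zero_le_one.trans (hw1 j))
  obtain ⟨hθ0, hθΘ⟩ := hθ i t ht
  obtain ⟨hτr, hτT⟩ := hτ i t ht
  have hself : |min (Q i) (max 0 (q (t - τ i t) i)) - qstar i| ≤ C * w i := by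
    have h := abs_clamp_sub_clamp_le (Q i) (q (t - τ i t) i) (qstar i)
    rw [hfix] at h
    exact h.trans (hwin _ ⟨by linarith, by linarith⟩ i)
  have hsN : ∀ j, |sNorm (fun s => q s j - qstar j) (t - T) (t - r)| ≤ C * w j := by
    intro j
    have hnn : 0 ≤ sNorm (fun s => q s j - qstar j) (t - T) (t - r) :=
      Real.sSup_nonneg (by rintro _ ⟨s, -, rfl⟩; exact abs_nonneg _)
    rw [abs_of_nonneg hnn]
    exact Real.sSup_le (by rintro _ ⟨s, hs, rfl⟩; exact hwin s hs j) (hw0 j)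
  have hother : |min (Q i) (max 0 ((a * b - c i) / (2 * b + K i) -
        R i * ∑ j ∈ Finset.univ.erase i, min (Q j) (max 0 (qstar j +
            d i j t * sNorm (fun s => q s j - qstar j) (t - T) (t - r))))) - qstar i|
      ≤ ρ * (C * w i) := by
    conv_lhs => rw [hNash i]
    refine (abs_clamp_sub_clamp_le _ _ _).trans ?_
    rw [sub_sub_sub_cancel_left, ← mul_sub, ← Finset.sum_sub_distrib, abs_mul,
      abs_of_pos (hR i)]
    have hs : |∑ j ∈ Finset.univ.erase i, (qstar j - min (Q j) (max 0 (qstar j +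
          d i j t * sNorm (fun s => q s j - qstar j) (t - T) (t - r))))|
        ≤ C * ∑ j ∈ Finset.univ.erase i, w j := by
      rw [Finset.mul_sum]
      refine (Finset.abs_sum_le_sum_abs _ _).trans (Finset.sum_le_sum fun j hj => ?_)
      have h := abs_clamp_sub_clamp_le (Q j) (qstar j) (qstar j +
          d i j t * sNorm (fun s => q s j - qstar j) (t - T) (t - r))
      rw [hfix, sub_add_cancel_left, abs_neg, abs_mul] at h
      refine h.trans ((mul_le_of_le_one_left (abs_nonneg _) ?_).trans (hsN j))
      exact abs_le.2 (hd i j t (Finset.ne_of_mem_erase hj).symm ht)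
    calc _ ≤ R i * (C * ∑ j ∈ Finset.univ.erase i, w j) :=
          mul_le_mul_of_nonneg_left hs (hR i).le
      _ = C * (R i * ∑ j ∈ Finset.univ.erase i, w j) := by ring
      _ ≤ C * (ρ * w i) := mul_le_mul_of_nonneg_left (hw i) hC
      _ = _ := by ring
  rw [heq t ht i]
  set A := min (Q i) (max 0 (q (t - τ i t) i))
  set B := min (Q i) (max 0 ((a * b - c i) / (2 * b + K i) -
        R i * ∑ j ∈ Finset.univ.erase i, min (Q j) (max 0 (qstar j +
            d i j t * sNorm (fun s => q s j - qstar j) (t - T) (t - r)))))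
  have h1θ : 0 ≤ 1 - θ i t := by linarith
  calc |θ i t * A + (1 - θ i t) * B - qstar i|
      = |θ i t * (A - qstar i) + (1 - θ i t) * (B - qstar i)| := by ring_nf
    _ ≤ θ i t * |A - qstar i| + (1 - θ i t) * |B - qstar i| := by
        refine (abs_add_le _ _).trans_eq ?_
        rw [abs_mul, abs_mul, abs_of_nonneg hθ0, abs_of_nonneg h1θ]
    _ ≤ θ i t * (C * w i) + (1 - θ i t) * (ρ * (C * w i)) := by gcongr
    _ = (ρ + θ i t * (1 - ρ)) * (C * w i) := by ring
    _ ≤ (ρ + Θ * (1 - ρ)) * (C * w i) := by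
        have : 0 ≤ 1 - ρ := by linarith
        have := hw0 i
        gcongr
    _ = _ := by ring

/-- Theorem 2.2 (trajectory form): under the small-gain conditions (2.15), the Nash
equilibrium of the Cournot oligopoly is robustly globally asymptotically stable:
every admissible trajectory converges to `q*`, and stability holds uniformly over all
admissible uncertainties. -/
theorem cournot_nash_RGAS (n : ℕ) (hn : 2 ≤ n) (a b : ℝ) (ha : 0 < a) (hb : 0 < b)
    (Q c K : Fin n → ℝ) (hQ : ∀ i, 0 < Q i) (haQ : ∑ i, Q i ≤ a)
    (hbK : ∀ i, 0 < 2 * b + K i)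
    (R : Fin n → ℝ) (hR : ∀ i, R i = b / (2 * b + K i))
    (qstar : Fin n → ℝ) (hqstarS : ∀ i, qstar i ∈ Set.Icc 0 (Q i))
    (hNash : ∀ i, qstar i = min (Q i) (max 0 ((a * b - c i) / (2 * b + K i) -
      R i * ∑ j ∈ Finset.univ.erase i, qstar j)))
    (hSG : ∀ p : ℕ, 2 ≤ p → p ≤ n → ∀ ι : Fin p → Fin n, Function.Injective ι →
      (∏ j, R (ι j)) * ((n : ℝ) - 1) ^ p < 1)
    (Θ r T : ℝ) (hΘ0 : 0 ≤ Θ) (hΘ1 : Θ < 1) (hr : 0 < r) (hrT : r ≤ T) :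
    (∀ θ τ d q, CournotAdmissible n a b Q c K R qstar Θ r T θ τ d q →
      ∀ ε > 0, ∃ M : ℝ, ∀ t ≥ M, eNorm (fun i => q t i - qstar i) ≤ ε) ∧
    (∀ ε > 0, ∃ δ > 0, ∀ θ τ d q, CournotAdmissible n a b Q c K R qstar Θ r T θ τ d q →
      vNorm (fun s i => q s i - qstar i) (-T) 0 ≤ δ →
      ∀ t ≥ 0, eNorm (fun i => q t i - qstar i) ≤ ε) := by
  have hRpos : ∀ i, 0 < R i := fun i => hR i ▸ div_pos hb (hbK i)
  have hpair : ∀ i j, i ≠ j → R i * R j * ((n : ℝ) - 1) ^ 2 < 1 := by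
    intro i j hij
    have hinj : Function.Injective ![i, j] := by
      intro x y hxy
      fin_cases x <;> fin_cases y
      · rfl
      · exact absurd hxy hij
      · exact absurd hxy hij.symm
      · rfl
    simpa [Fin.prod_univ_two] using hSG 2 le_rfl hn ![i, j] hinj
  obtain ⟨w, ρ, hw1, hρ0, hρ1, hw⟩ := exists_contraction_weights hn R hRpos hpair
  have hT : 0 < T := hr.trans_le hrT
  have hΘ' : 0 < 1 - Θ := by linarith
  have hlam0 : 0 ≤ Θ + (1 - Θ) * ρ := by positivity
  have hlam1 : Θ + (1 - Θ) * ρ < 1 := by nlinarith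
  have hWpos : 0 < ∑ i, w i :=
    Finset.sum_pos (fun i _ => zero_lt_one.trans_le (hw1 i)) ⟨⟨0, by omega⟩, Finset.mem_univ _⟩
  have hnorm : ∀ (v : Fin n → ℝ) (C : ℝ), (∀ i, |v i| ≤ C * w i) → eNorm v ≤ C * ∑ i, w i := by
    intro v C hv
    rw [Finset.mul_sum]
    exact (eNorm_le_sum_abs v).trans (Finset.sum_le_sum fun i _ => hv i)
  have hbdd : ∀ θ τ d q, CournotAdmissible n a b Q c K R qstar Θ r T θ τ d q →
      ∀ t, -T ≤ t → ∀ i, |q t i - qstar i| ≤ Q i := by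
    intro θ τ d q hq t ht i
    obtain ⟨h1, h2⟩ := hq.2.2.2.1 t ht i
    obtain ⟨h3, h4⟩ := hqstarS i
    exact abs_le.2 ⟨by linarith, by linarith⟩
  constructor
  · intro θ τ d q hq ε hε
    have hC0 : 0 ≤ ∑ i, Q i := Finset.sum_nonneg fun i _ => (hQ i).le
    have hdecay : ∀ k : ℕ, ∀ t, k * T - T ≤ t → ∀ i,
        |q t i - qstar i| ≤ (Θ + (1 - Θ) * ρ) ^ k * (∑ i, Q i) * w i := by
      intro k
      induction k with
      | zero =>
        intro t ht i
        have hQi : Q i ≤ ∑ i, Q i :=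
          Finset.single_le_sum (fun j _ => (hQ j).le) (Finset.mem_univ i)
        have h := hbdd θ τ d q hq t (by simpa using ht) i
        rw [pow_zero, one_mul]
        exact (h.trans hQi).trans (le_mul_of_one_le_right hC0 (hw1 i))
      | succ k ih =>
        intro t ht i
        push_cast at ht
        have hkT : 0 ≤ (k : ℝ) * T := by positivity
        refine (hq.abs_sub_le hRpos hqstarS hNash hΘ1 hw1 hρ1 hw
          (mul_nonneg (pow_nonneg hlam0 k) hC0) (by linarith)
          (fun s hs j => ih s (by linarith [hs.1]) j) i).trans_eq ?_
        ring
    have htend : Tendsto (fun k : ℕ => (Θ + (1 - Θ) * ρ) ^ k * (∑ i, Q i) * ∑ i, w i)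
        atTop (𝓝 0) := by
      simpa using ((tendsto_pow_atTop_nhds_zero_of_lt_one hlam0 hlam1).mul_const
        (∑ i, Q i)).mul_const (∑ i, w i)
    obtain ⟨k, hk⟩ := (htend.eventually (eventually_le_nhds hε)).exists
    exact ⟨k * T - T, fun t ht => (hnorm _ _ (hdecay k t ht)).trans hk⟩
  · intro ε hε
    have hδ : 0 < ε / ∑ i, w i := div_pos hε hWpos
    refine ⟨ε / ∑ i, w i, hδ, fun θ τ d q hq hv t ht => ?_⟩
    have hinit : ∀ s ∈ Set.Icc (-T) 0, ∀ i, |q s i - qstar i| ≤ (ε / ∑ i, w i) * w i := by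
      intro s hs i
      have hBA : BddAbove ((fun s => eNorm (fun i => q s i - qstar i)) '' Set.Icc (-T) 0) := by
        refine ⟨∑ i, Q i, ?_⟩
        rintro _ ⟨u, hu, rfl⟩
        exact (eNorm_le_sum_abs _).trans
          (Finset.sum_le_sum fun i _ => hbdd θ τ d q hq u hu.1 i)
      have h1 : eNorm (fun i => q s i - qstar i) ≤ ε / ∑ i, w i :=
        (le_csSup hBA ⟨s, hs, rfl⟩).trans hv
      exact ((abs_apply_le_eNorm (fun i => q s i - qstar i) i).trans h1).trans
        (le_mul_of_one_le_right hδ.le (hw1 i))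
    have hprop : ∀ m : ℕ, ∀ s, -T ≤ s → s ≤ m * r → ∀ i,
        |q s i - qstar i| ≤ (ε / ∑ i, w i) * w i := by
      intro m
      induction m with
      | zero => exact fun s h1 h2 i => hinit s ⟨h1, by simpa using h2⟩ i
      | succ m ih =>
        intro s h1 h2 i
        push_cast at h2
        rcases le_total s 0 with hs | hs
        · exact hinit s ⟨h1, hs⟩ i
        · have h := hq.abs_sub_le hRpos hqstarS hNash hΘ1 hw1 hρ1 hw hδ.le hs
            (fun u hu j => ih u (by linarith [hu.1]) (by linarith [hu.2]) j) i
          refine h.trans (mul_le_mul_of_nonneg_right ?_ (zero_le_one.trans (hw1 i)))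
          exact mul_le_of_le_one_left hδ.le hlam1.le
    obtain ⟨m, hm⟩ := exists_nat_ge (t / r)
    have h := hnorm _ _ (hprop m t (by linarith) ((div_le_iff₀ hr).1 hm))
    rwa [div_mul_cancel₀ _ hWpos.ne'] at h
end

section
/- Let n ≥ 2, 0 < r ≤ T, 0 ≤ Θ < 1, and let γ̃_{i,j} (i ≠ j, i,j = 1,…,n) be functions of class N. Suppose there exists ω > 1 such that the cyclic small-gain conditions (3.15) hold for γ_{i,j}(s) := ω·γ̃_{i,j}(ω s). Let x_i : [−T,∞) → ℝ^{k_i} (i = 1,…,n) be bounded functions such that for every t ≥ 0 and every i there exists θ ∈ [0,Θ] with |x_i(t)| ≤ θ·‖x_i‖_{[t−T,t−r]} + (1−θ)·max_{j≠i} γ̃_{i,j}(‖x_j‖_{[t−T,t−r]}). Then lim_{t→∞} x_i(t) = 0 for every i; moreover, for every ε > 0 there exists δ > 0 such that every such family (x_1,…,x_n) with max_i ‖x_i‖_{[−T,0]} ≤ δ satisfies |x_i(t)| ≤ ε for all t ≥ 0 and all i. -/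
open scoped BigOperators

/-- Max over indices `j ≠ i` of a finite family of reals (as a supremum). -/
noncomputable def maxNe {n : ℕ} (i : Fin n) (g : Fin n → ℝ) : ℝ :=
  sSup {y | ∃ j, j ≠ i ∧ y = g j}

/-- A function `γ : [0,∞) → [0,∞)` of class N: continuous, non-decreasing, `γ(0)=0`. -/
def ClassN (γ : ℝ → ℝ) : Prop :=
  ContinuousOn γ (Set.Ici 0) ∧ MonotoneOn γ (Set.Ici 0) ∧ γ 0 = 0 ∧ ∀ s, 0 ≤ s → 0 ≤ γ s

/-- The cyclic composition `γ_{ι 0, ι 1} ∘ γ_{ι 1, ι 2} ∘ ⋯ ∘ γ_{ι (p-1), ι 0}`. -/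
noncomputable def cyclicComp {n p : ℕ} (γ : Fin n → Fin n → ℝ → ℝ) (ι : Fin p → Fin n) :
    ℝ → ℝ :=
  (List.ofFn (fun j : Fin p =>
    γ (ι j) (ι ⟨(j.1 + 1) % p, Nat.mod_lt _ j.pos⟩))).foldr (· ∘ ·) id

/-- Admissible trajectory for the uncertain small-gain model (3.9):
bounded, and satisfying the convex-combination estimate with gains `γ̃_{i,j}` over the
delayed window `[t-T, t-r]`. -/
def SGTraj (n : ℕ) (k : Fin n → ℕ) (r T Θ : ℝ) (γ : Fin n → Fin n → ℝ → ℝ)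
    (x : (i : Fin n) → ℝ → Fin (k i) → ℝ) : Prop :=
  (∃ M : ℝ, ∀ i, ∀ t, -T ≤ t → eNorm (x i t) ≤ M) ∧
  (∀ t, 0 ≤ t → ∀ i, ∃ θ, θ ∈ Set.Icc 0 Θ ∧
    eNorm (x i t) ≤ θ * vNorm (x i) (t - T) (t - r) +
      (1 - θ) * maxNe i (fun j => γ i j (vNorm (x j) (t - T) (t - r))))

lemma eNorm_nonneg {m : ℕ} (v : Fin m → ℝ) : 0 ≤ eNorm v := Real.sqrt_nonneg _

lemma erase_nonempty {n : ℕ} (hn : 2 ≤ n) (i : Fin n) : (Finset.univ.erase i).Nonempty := by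
  rw [← Finset.card_pos, Finset.card_erase_of_mem (Finset.mem_univ i), Finset.card_univ,
    Fintype.card_fin]
  omega

lemma maxNe_eq_sup' {n : ℕ} (hn : 2 ≤ n) (i : Fin n) (g : Fin n → ℝ) :
    maxNe i g = (Finset.univ.erase i).sup' (erase_nonempty hn i) g := by
  rw [Finset.sup'_eq_csSup_image, maxNe]
  congr 1
  ext y
  simp [eq_comm]

lemma exists_maxNe_eq {n : ℕ} (hn : 2 ≤ n) (i : Fin n) (g : Fin n → ℝ) :
    ∃ j, j ≠ i ∧ maxNe i g = g j := by
  obtain ⟨j, hj, h⟩ := Finset.exists_mem_eq_sup' (erase_nonempty hn i) g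
  exact ⟨j, Finset.ne_of_mem_erase hj, (maxNe_eq_sup' hn i g).trans h⟩

lemma le_maxNe {n : ℕ} (hn : 2 ≤ n) {i j : Fin n} (hj : j ≠ i) (g : Fin n → ℝ) :
    g j ≤ maxNe i g := by
  rw [maxNe_eq_sup' hn]
  exact Finset.le_sup' g (by simp [hj])

lemma maxNe_gain_mono {n : ℕ} (hn : 2 ≤ n) {γ : Fin n → Fin n → ℝ → ℝ}
    (hγ : ∀ i j, i ≠ j → ClassN (γ i j)) (i : Fin n) {s s' : Fin n → ℝ}
    (hs : ∀ j, 0 ≤ s j) (hss' : ∀ j, s j ≤ s' j) :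
    maxNe i (fun j => γ i j (s j)) ≤ maxNe i (fun j => γ i j (s' j)) := by
  obtain ⟨j, hj, h⟩ := exists_maxNe_eq hn i (fun j => γ i j (s j))
  rw [h]
  exact ((hγ i j hj.symm).2.1 (hs j) ((hs j).trans (hss' j)) (hss' j)).trans
    (le_maxNe hn hj (fun j => γ i j (s' j)))

lemma maxNe_gain_nonneg {n : ℕ} (hn : 2 ≤ n) {γ : Fin n → Fin n → ℝ → ℝ}
    (hγ : ∀ i j, i ≠ j → ClassN (γ i j)) (i : Fin n) {s : Fin n → ℝ}
    (hs : ∀ j, 0 ≤ s j) : 0 ≤ maxNe i (fun j => γ i j (s j)) := by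
  obtain ⟨j, hj, h⟩ := exists_maxNe_eq hn i (fun j => γ i j (s j))
  rw [h]
  exact (hγ i j hj.symm).2.2.2 _ (hs j)

open Filter Topology in
lemma tendsto_maxNe_gain {n : ℕ} (hn : 2 ≤ n) {γ : Fin n → Fin n → ℝ → ℝ}
    (hγ : ∀ i j, i ≠ j → ClassN (γ i j)) (i : Fin n) {s : ℕ → Fin n → ℝ} {a : Fin n → ℝ}
    (hs : ∀ m j, 0 ≤ s m j) (h : ∀ j, Tendsto (fun m => s m j) atTop (𝓝 (a j))) :
    Tendsto (fun m => maxNe i (fun j => γ i j (s m j))) atTop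
      (𝓝 (maxNe i (fun j => γ i j (a j)))) := by
  simp only [maxNe_eq_sup' hn]
  refine Tendsto.finset_sup'_nhds_apply _ fun j hj => ?_
  have ha : 0 ≤ a j := ge_of_tendsto' (h j) fun m => hs m j
  exact (((hγ i j (Finset.ne_of_mem_erase hj).symm).1 (a j) ha).tendsto).comp
    (tendsto_nhdsWithin_iff.2 ⟨h j, Eventually.of_forall fun m => hs m j⟩)

/-- A chain of estimates `a j ≤ G j (a (j + 1))` through nondecreasing maps composes. -/
lemma le_foldr_comp {p : ℕ} (G : Fin p → ℝ → ℝ) (hG : ∀ j, MonotoneOn (G j) (Set.Ici 0))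
    (a : ℕ → ℝ) (ha : ∀ j, 0 ≤ a j) (h : ∀ j : Fin p, a j ≤ G j (a (j + 1))) :
    a 0 ≤ (List.ofFn G).foldr (· ∘ ·) id (a p) := by
  induction p generalizing a with
  | zero => simp
  | succ p ih =>
    have key := ih (fun j => G j.succ) (fun j => hG _) (fun j => a (j + 1)) (fun j => ha _)
      (fun j => by simpa using h j.succ)
    simp only [List.ofFn_succ, List.foldr_cons, Function.comp_apply]
    exact (h 0).trans (hG 0 (ha _) ((ha _).trans key) (by simpa using key))

/-- Under the cyclic small-gain conditions the gain operator has no nonzero nonnegative vector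
lying below its image. -/
lemma eq_zero_of_le_maxNe {n : ℕ} (hn : 2 ≤ n) {γ : Fin n → Fin n → ℝ → ℝ}
    (hγ : ∀ i j, i ≠ j → ClassN (γ i j)) {ω : ℝ} (hω : 1 < ω)
    (hSG : ∀ p : ℕ, 2 ≤ p → p ≤ n → ∀ ι : Fin p → Fin n, Function.Injective ι →
      ∀ s : ℝ, 0 < s → cyclicComp (fun i j s => ω * γ i j (ω * s)) ι s < s)
    {s : Fin n → ℝ} (hs : ∀ i, 0 ≤ s i) (h : ∀ i, s i ≤ maxNe i (fun j => γ i j (s j))) :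
    ∀ i, s i = 0 := by
  by_contra! hne
  obtain ⟨i₀, hi₀⟩ := hne
  have hstep : ∀ i : {i // 0 < s i}, ∃ j : {i // 0 < s i},
      j.1 ≠ i.1 ∧ s i ≤ γ i j (s j) := by
    rintro ⟨i, hi⟩
    obtain ⟨j, hj, hjm⟩ := exists_maxNe_eq hn i (fun j => γ i j (s j))
    have hle : s i ≤ γ i j (s j) := hjm ▸ h i
    refine ⟨⟨j, (hs j).lt_of_ne fun h0 => ?_⟩, hj, hle⟩
    rw [← h0, (hγ i j hj.symm).2.2.1] at hle
    exact absurd hi hle.not_gt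
  choose f hf_ne hf_le using hstep
  obtain ⟨x, p, hp, hinj, hper⟩ : ∃ (x : {i // 0 < s i}) (p : ℕ), 0 < p ∧
      Set.InjOn (fun j => f^[j] x) (Set.Iio p) ∧ f^[p] x = x := by
    let y : {i // 0 < s i} := ⟨i₀, (hs i₀).lt_of_ne' hi₀⟩
    obtain ⟨a, b, hab, he⟩ := Finite.exists_ne_map_eq_of_infinite (fun j : ℕ => f^[j] y)
    wlog hlt : a < b generalizing a b
    · exact this b a hab.symm he.symm (by omega)
    have hpt : Function.IsPeriodicPt f (b - a) (f^[a] y) := by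
      change f^[b - a] (f^[a] y) = f^[a] y
      rw [← Function.iterate_add_apply, Nat.sub_add_cancel hlt.le]
      exact he.symm
    refine ⟨f^[a] y, Function.minimalPeriod f (f^[a] y),
      hpt.minimalPeriod_pos (by omega), ?_, Function.iterate_minimalPeriod⟩
    exact Function.iterate_injOn_Iio_minimalPeriod
  have hp2 : 2 ≤ p := by
    by_contra hlt
    obtain rfl : p = 1 := by omega
    exact hf_ne x (congrArg Subtype.val hper)
  let ι : Fin p → Fin n := fun j => (f^[j] x).1
  have hι : Function.Injective ι := fun a b hab =>
    Fin.ext (hinj a.2 b.2 (Subtype.ext hab))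
  have hpn : p ≤ n := by simpa using Fintype.card_le_of_injective ι hι
  have hsucc : ∀ j : Fin p,
      ι ⟨(j.1 + 1) % p, Nat.mod_lt _ j.pos⟩ = (f^[j.1 + 1] x).1 := by
    intro j
    change (f^[(j.1 + 1) % p] x).1 = _
    rw [Function.IsPeriodicPt.iterate_mod_apply (f := f) hper]
  have hne : ∀ j : ℕ, (f^[j] x).1 ≠ (f^[j + 1] x).1 := fun j => by
    rw [Function.iterate_succ_apply']
    exact (hf_ne _).symm
  have key := le_foldr_comp
    (fun j : Fin p => (fun i j s => ω * γ i j (ω * s)) (ι j)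
      (ι ⟨(j.1 + 1) % p, Nat.mod_lt _ j.pos⟩)) ?_ (fun j => s (f^[j] x).1) (fun j => hs _) ?_
  · simp only [hper] at key
    exact absurd (hSG p hp2 hpn ι hι (s x.1) x.2) key.not_gt
  · intro j u hu v hv huv
    simp only [hsucc]
    have hω0 : 0 ≤ ω := by linarith
    exact mul_le_mul_of_nonneg_left ((hγ _ _ (hne j)).2.1 (mul_nonneg hω0 hu)
      (mul_nonneg hω0 hv) (mul_le_mul_of_nonneg_left huv hω0)) hω0
  · intro j
    simp only [hsucc]
    have hle := hf_le (f^[j.1] x)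
    rw [← Function.iterate_succ_apply' f j.1 x] at hle
    have h0 := hs (f^[j.1 + 1] x).1
    have hc := hγ _ _ (hne j)
    have hω0 : 0 ≤ ω * s (f^[j.1 + 1] x).1 := by nlinarith
    have h1 := hc.2.1 h0 hω0 (by nlinarith)
    have h2 := hc.2.2.2 _ hω0
    refine hle.trans (h1.trans ?_)
    change _ ≤ ω * _
    nlinarith

open Filter Topology in
/-- Arbitrarily small boxes with positive side lengths are invariant under the gain operator as
soon as it has no nonzero nonnegative vector lying below its image. -/
lemma exists_invariant_box {n : ℕ} (hn : 2 ≤ n) {γ : Fin n → Fin n → ℝ → ℝ}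
    (hγ : ∀ i j, i ≠ j → ClassN (γ i j))
    (H : ∀ s : Fin n → ℝ, (∀ i, 0 ≤ s i) → (∀ i, s i ≤ maxNe i (fun j => γ i j (s j))) →
      ∀ i, s i = 0) {ε : ℝ} (hε : 0 < ε) :
    ∃ δ > 0, ∃ b : Fin n → ℝ, ∀ i, δ ≤ b i ∧ b i ≤ ε ∧
      maxNe i (fun j => γ i j (b j)) ≤ b i := by
  have hfix : ∀ δ : ℝ, 0 < δ → ∃ b : Fin n → ℝ, ∀ i, (0 ≤ b i ∧ b i ≤ ε) ∧
      b i = min ε (max δ (maxNe i (fun j => γ i j (b j)))) := by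
    intro δ hδ
    have : Fact ((0 : ℝ) ≤ ε) := ⟨hε.le⟩
    let F : (Fin n → Set.Icc (0 : ℝ) ε) →o (Fin n → Set.Icc (0 : ℝ) ε) :=
      { toFun := fun s i => ⟨min ε (max δ (maxNe i (fun j => γ i j (s j)))),
          le_min hε.le (hδ.le.trans (le_max_left _ _)), min_le_left _ _⟩
        monotone' := fun s s' hss' i => Subtype.mk_le_mk.2 <|
          min_le_min le_rfl (max_le_max le_rfl
            (maxNe_gain_mono hn hγ i (fun j => (s j).2.1) fun j => hss' j)) }
    refine ⟨fun i => (F.lfp i : ℝ), fun i => ⟨(F.lfp i).2, ?_⟩⟩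
    exact congrArg Subtype.val (congrFun (OrderHom.map_lfp F) i).symm
  choose! b hb hbfix using fun m : ℕ => (by
    obtain ⟨b, hb⟩ := hfix (1 / ((m : ℝ) + 1)) (by positivity)
    exact ⟨b, fun i => (hb i).1, fun i => (hb i).2⟩ : ∃ b : Fin n → ℝ,
      (∀ i, 0 ≤ b i ∧ b i ≤ ε) ∧
      ∀ i, b i = min ε (max (1 / ((m : ℝ) + 1)) (maxNe i (fun j => γ i j (b j)))))
  obtain ⟨a, ha, φ, hφ, hlim⟩ := (isCompact_Icc (a := (0 : Fin n → ℝ))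
    (b := fun _ => ε)).tendsto_subseq (x := b)
      (fun m => ⟨fun i => (hb m i).1, fun i => (hb m i).2⟩)
  have hlim' : ∀ i, Tendsto (fun m => b (φ m) i) atTop (𝓝 (a i)) := tendsto_pi_nhds.1 hlim
  have ha0 : ∀ i, a i = 0 := by
    refine H a ha.1 fun i => ?_
    have h1 : Tendsto (fun m => min ε (max (1 / ((φ m : ℝ) + 1))
        (maxNe i (fun j => γ i j (b (φ m) j))))) atTop
        (𝓝 (min ε (max 0 (maxNe i (fun j => γ i j (a j)))))) :=
      tendsto_const_nhds.min ((tendsto_one_div_add_atTop_nhds_zero_nat.comp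
        hφ.tendsto_atTop).max
          (tendsto_maxNe_gain hn hγ i (fun m j => (hb (φ m) j).1) hlim'))
    simp only [← hbfix] at h1
    rw [tendsto_nhds_unique (hlim' i) h1, max_eq_right (maxNe_gain_nonneg hn hγ i ha.1)]
    exact min_le_right _ _
  have hev : ∀ᶠ m in atTop, ∀ i, b (φ m) i < ε := eventually_all.2 fun i =>
    (hlim' i).eventually_lt_const (by rw [ha0 i]; exact hε)
  obtain ⟨m, hm⟩ := hev.exists
  refine ⟨1 / ((φ m : ℝ) + 1), by positivity, b (φ m), fun i => ?_⟩
  have hmax : max (1 / ((φ m : ℝ) + 1)) (maxNe i (fun j => γ i j (b (φ m) j))) ≤ b (φ m) i := by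
    have h1 := hbfix (φ m) i
    rcases min_choice ε (max (1 / ((φ m : ℝ) + 1))
      (maxNe i (fun j => γ i j (b (φ m) j)))) with h2 | h2
    · exact absurd (h1.trans h2) (hm i).ne
    · exact (h1.trans h2).ge
  exact ⟨(le_max_left _ _).trans hmax, (hm i).le, (le_max_right _ _).trans hmax⟩

lemma vNorm_le {m : ℕ} {x : ℝ → Fin m → ℝ} {α β c : ℝ} (hαβ : α ≤ β)
    (h : ∀ τ ∈ Set.Icc α β, eNorm (x τ) ≤ c) : vNorm x α β ≤ c :=
  csSup_le ((Set.nonempty_Icc.2 hαβ).image _) (by rintro _ ⟨τ, hτ, rfl⟩; exact h τ hτ)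

lemma vNorm_nonneg {m : ℕ} (x : ℝ → Fin m → ℝ) (α β : ℝ) : 0 ≤ vNorm x α β :=
  Real.sSup_nonneg (by rintro _ ⟨τ, -, rfl⟩; exact eNorm_nonneg _)

/-- A box bounding a trajectory on the window `[t - T, t - r]` bounds it at time `t` through the
gains. -/
lemma SGTraj.eNorm_le {n : ℕ} (hn : 2 ≤ n) {k : Fin n → ℕ} {r T Θ : ℝ} (hrT : r ≤ T)
    (hΘ1 : Θ < 1) {γ : Fin n → Fin n → ℝ → ℝ} (hγ : ∀ i j, i ≠ j → ClassN (γ i j))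
    {x : (i : Fin n) → ℝ → Fin (k i) → ℝ} (hx : SGTraj n k r T Θ γ x) {t : ℝ} (ht : 0 ≤ t)
    {b : Fin n → ℝ} (hb : ∀ j, ∀ τ ∈ Set.Icc (t - T) (t - r), eNorm (x j τ) ≤ b j)
    (i : Fin n) :
    eNorm (x i t) ≤ max (maxNe i (fun j => γ i j (b j)))
      (Θ * b i + (1 - Θ) * maxNe i (fun j => γ i j (b j))) := by
  obtain ⟨θ, ⟨hθ0, hθ1⟩, h⟩ := hx.2 t ht i
  have hv : ∀ j, vNorm (x j) (t - T) (t - r) ≤ b j := fun j => vNorm_le (by linarith) (hb j)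
  have hmono := maxNe_gain_mono hn hγ i (fun j => vNorm_nonneg (x j) (t - T) (t - r)) hv
  have h1 := mul_le_mul_of_nonneg_left (hv i) hθ0
  have h2 := mul_le_mul_of_nonneg_left hmono (by linarith : 0 ≤ 1 - θ)
  rw [le_max_iff]
  rcases le_total (b i) (maxNe i (fun j => γ i j (b j))) with hle | hle
  · left; nlinarith
  · right; nlinarith

/-- Supremum of the Euclidean norm of a signal over `[α, ∞)`. -/
noncomputable def tailNorm {m : ℕ} (x : ℝ → Fin m → ℝ) (α : ℝ) : ℝ :=
  sSup ((fun τ => eNorm (x τ)) '' Set.Ici α)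

open Filter Topology in
lemma SGTraj.exists_eNorm_le {n : ℕ} (hn : 2 ≤ n) {k : Fin n → ℕ} {r T Θ : ℝ} (hr : 0 < r)
    (hrT : r ≤ T) (hΘ1 : Θ < 1) {γ : Fin n → Fin n → ℝ → ℝ}
    (hγ : ∀ i j, i ≠ j → ClassN (γ i j))
    (H : ∀ s : Fin n → ℝ, (∀ i, 0 ≤ s i) → (∀ i, s i ≤ maxNe i (fun j => γ i j (s j))) →
      ∀ i, s i = 0)
    {x : (i : Fin n) → ℝ → Fin (k i) → ℝ} (hx : SGTraj n k r T Θ γ x) (i : Fin n)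
    {ε : ℝ} (hε : 0 < ε) : ∃ M : ℝ, ∀ t ≥ M, eNorm (x i t) ≤ ε := by
  obtain ⟨M, hM⟩ := hx.1
  let α : ℕ → ℝ := fun m => m * T - T
  have hT : 0 < T := hr.trans_le hrT
  have hα : ∀ m, -T ≤ α m := fun m => by
    have : 0 ≤ (m : ℝ) * T := by positivity
    change -T ≤ m * T - T
    linarith
  have hαs : ∀ m, α (m + 1) = α m + T := fun m => by simp only [α]; push_cast; ring
  let u : ℕ → Fin n → ℝ := fun m i => tailNorm (x i) (α m)
  have hle : ∀ m j t, α m ≤ t → eNorm (x j t) ≤ u m j := fun m j t ht =>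
    le_csSup ⟨M, by rintro _ ⟨τ, hτ, rfl⟩; exact hM j τ ((hα m).trans hτ)⟩ ⟨t, ht, rfl⟩
  have hule : ∀ m j c, (∀ t, α m ≤ t → eNorm (x j t) ≤ c) → u m j ≤ c := fun m j c h =>
    csSup_le (Set.nonempty_Ici.image _) (by rintro _ ⟨τ, hτ, rfl⟩; exact h τ hτ)
  have hu0 : ∀ m j, 0 ≤ u m j := fun m j =>
    (eNorm_nonneg _).trans (hle m j (α m) le_rfl)
  have hanti : ∀ j, Antitone (fun m => u m j) := fun j =>
    antitone_nat_of_succ_le fun m => hule _ _ _ fun t ht =>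
      hle m j t (by rw [hαs] at ht; linarith)
  have hlim : ∀ j, Tendsto (fun m => u m j) atTop (𝓝 (⨅ m, u m j)) := fun j =>
    tendsto_atTop_ciInf (hanti j) ⟨0, by rintro _ ⟨m, rfl⟩; exact hu0 m j⟩
  have hstep : ∀ m j, u (m + 1) j ≤ max (maxNe j (fun l => γ j l (u m l)))
      (Θ * u m j + (1 - Θ) * maxNe j (fun l => γ j l (u m l))) := fun m j =>
    hule _ _ _ fun t ht => hx.eNorm_le hn hrT hΘ1 hγ
      (by rw [hαs] at ht; linarith [hα m])
      (fun l τ hτ => hle m l τ (by rw [hαs] at ht; linarith [hτ.1])) j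
  have hzero : ∀ j, ⨅ m, u m j = 0 := by
    refine H (fun j => ⨅ m, u m j) (fun j => le_ciInf fun m => hu0 m j) fun j => ?_
    have hg := tendsto_maxNe_gain hn hγ j hu0 hlim
    have h1 := le_of_tendsto_of_tendsto' ((tendsto_add_atTop_iff_nat 1).2 (hlim j))
      (hg.max (((hlim j).const_mul Θ).add (hg.const_mul (1 - Θ)))) fun m => hstep m j
    rcases le_max_iff.1 h1 with h2 | h2
    · exact h2
    · change (⨅ m, u m j) ≤ _
      nlinarith
  have hev := (hlim i).eventually_lt_const (u := ε) (by rw [hzero i]; exact hε)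
  obtain ⟨m, hm⟩ := hev.exists
  exact ⟨α m, fun t ht => (hle m i t ht).trans hm.le⟩

/-- A box that is invariant under the gains and contains the initial history contains the whole
trajectory. -/
lemma SGTraj.eNorm_le_of_invariant {n : ℕ} (hn : 2 ≤ n) {k : Fin n → ℕ} {r T Θ : ℝ}
    (hr : 0 < r) (hrT : r ≤ T) (hΘ1 : Θ < 1) {γ : Fin n → Fin n → ℝ → ℝ}
    (hγ : ∀ i j, i ≠ j → ClassN (γ i j))
    {x : (i : Fin n) → ℝ → Fin (k i) → ℝ} (hx : SGTraj n k r T Θ γ x)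
    {b : Fin n → ℝ} (hb : ∀ i, maxNe i (fun j => γ i j (b j)) ≤ b i)
    (h0 : ∀ i, ∀ t ∈ Set.Icc (-T) 0, eNorm (x i t) ≤ b i) {t : ℝ} (ht : 0 ≤ t) (i : Fin n) :
    eNorm (x i t) ≤ b i := by
  have key : ∀ m : ℕ, ∀ i t, -T ≤ t → t ≤ m * r → eNorm (x i t) ≤ b i := by
    intro m
    induction m with
    | zero => exact fun i t h1 h2 => h0 i t ⟨h1, by simpa using h2⟩
    | succ m ih =>
      intro i t h1 h2
      rcases le_total t 0 with ht | ht
      · exact h0 i t ⟨h1, ht⟩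
      · push_cast at h2
        refine (hx.eNorm_le hn hrT hΘ1 hγ ht (b := b)
          (fun j τ hτ => ih j τ (by linarith [hτ.1]) (by linarith [hτ.2])) i).trans ?_
        exact max_le (hb i) (by nlinarith [hb i])
  obtain ⟨m, hm⟩ := exists_nat_ge (t / r)
  exact key m i t (by linarith) ((div_le_iff₀ hr).1 hm)

/-- Theorem 3.1 (trajectory form): under the cyclic small-gain conditions (3.15) the origin
is robustly globally asymptotically stable: every admissible trajectory converges to 0, and
stability holds uniformly over all admissible uncertainties. -/
theorem smallgain_RGAS (n : ℕ) (hn : 2 ≤ n) (r T Θ : ℝ) (hr : 0 < r) (hrT : r ≤ T)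
    (hΘ0 : 0 ≤ Θ) (hΘ1 : Θ < 1) (k : Fin n → ℕ)
    (γt : Fin n → Fin n → ℝ → ℝ) (hγ : ∀ i j, i ≠ j → ClassN (γt i j))
    (ω : ℝ) (hω : 1 < ω)
    (hSG : ∀ p : ℕ, 2 ≤ p → p ≤ n → ∀ ι : Fin p → Fin n, Function.Injective ι →
      ∀ s : ℝ, 0 < s → cyclicComp (fun i j s => ω * γt i j (ω * s)) ι s < s) :
    (∀ x : (i : Fin n) → ℝ → Fin (k i) → ℝ, SGTraj n k r T Θ γt x →
      ∀ i, ∀ ε > 0, ∃ M : ℝ, ∀ t ≥ M, eNorm (x i t) ≤ ε) ∧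
    (∀ ε > 0, ∃ δ > 0, ∀ x : (i : Fin n) → ℝ → Fin (k i) → ℝ, SGTraj n k r T Θ γt x →
      (∀ i, vNorm (x i) (-T) 0 ≤ δ) → ∀ t ≥ 0, ∀ i, eNorm (x i t) ≤ ε) := by
  have H := fun (s : Fin n → ℝ) => eq_zero_of_le_maxNe (s := s) hn hγ hω hSG
  refine ⟨fun x hx i ε hε => hx.exists_eNorm_le hn hr hrT hΘ1 hγ H i hε, fun ε hε => ?_⟩
  obtain ⟨δ, hδ, b, hb⟩ := exists_invariant_box hn hγ H hε
  refine ⟨δ, hδ, fun x hx hx0 t ht i => le_trans ?_ (hb i).2.1⟩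
  refine hx.eNorm_le_of_invariant hn hr hrT hΘ1 hγ (fun i => (hb i).2.2)
    (fun i t ht => le_trans ?_ ((hx0 i).trans (hb i).1)) ht i
  obtain ⟨M, hM⟩ := hx.1
  exact le_csSup ⟨M, by rintro _ ⟨τ, hτ, rfl⟩; exact hM i τ hτ.1⟩ ⟨t, ht, rfl⟩
end

section
/- Let γ, δ : [0,∞) → [0,∞) be functions of class N. If γ(δ(s)) < s for all s > 0, then δ(γ(s)) < s for all s > 0. -/
/-- If `γ, δ` are of class N and `γ(δ(s)) < s` for all `s > 0`, then also
`δ(γ(s)) < s` for all `s > 0`. -/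
theorem classN_comp_swap (γ δ : ℝ → ℝ) (hγ : ClassN γ) (hδ : ClassN δ)
    (h : ∀ s : ℝ, 0 < s → γ (δ s) < s) : ∀ s : ℝ, 0 < s → δ (γ s) < s := by
  intro s hs
  obtain ⟨-, -, -, hγ_nonneg⟩ := hγ
  obtain ⟨hδ_cont, -, hδ_zero, -⟩ := hδ
  by_contra! hle
  obtain ⟨t, ⟨ht0, ht⟩, hts⟩ := intermediate_value_Icc (hγ_nonneg s hs.le)
    (hδ_cont.mono Set.Icc_subset_Ici_self) ⟨hδ_zero.trans_le hs.le, hle⟩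
  have ht_pos : 0 < t := ht0.lt_of_ne (by rintro rfl; exact hs.ne (hδ_zero.symm.trans hts))
  have hlt := h t ht_pos
  rw [hts] at hlt
  exact hlt.not_ge ht
end

section
/- Let μ > 0, r > 0, let F : [0,∞) → ℝ be continuous, and let q : [0,∞) → ℝ be differentiable with q′(t) = μ·(F(t) − q(t)) for all t ≥ 0. Then for every t ≥ r there exists ξ ∈ [t−r, t] such that q(t) = e^{−μr}·q(t−r) + (1 − e^{−μr})·F(ξ). -/
/-- Continuous-time representation lemma: if `q' = μ (F - q)` on `[0,∞)` with `F`
continuous, then for every `t ≥ r` there is `ξ ∈ [t-r, t]` with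
`q(t) = e^{-μr} q(t-r) + (1 - e^{-μr}) F(ξ)`. -/
theorem ode_mean_value_representation (μ r : ℝ) (hμ : 0 < μ) (hr : 0 < r)
    (F q : ℝ → ℝ) (hF : ContinuousOn F (Set.Ici 0))
    (hq : ∀ t, 0 ≤ t → HasDerivWithinAt q (μ * (F t - q t)) (Set.Ici 0) t) :
    ∀ t, r ≤ t → ∃ ξ ∈ Set.Icc (t - r) t,
      q t = Real.exp (-μ * r) * q (t - r) + (1 - Real.exp (-μ * r)) * F ξ := by
  intro t ht
  have hexp (x : ℝ) : HasDerivAt (fun s => Real.exp (μ * s)) (Real.exp (μ * x) * μ) x := by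
    simpa using ((hasDerivAt_id x).const_mul μ).exp
  have hexp_cont : Continuous fun s => Real.exp (μ * s) := by fun_prop
  have hq_cont : ContinuousOn q (Set.Icc (t - r) t) := fun x hx =>
    (hq x (by linarith [hx.1])).continuousWithinAt.mono fun y hy =>
      Set.mem_Ici.2 (by linarith [hy.1])
  -- Cauchy's mean value theorem for `exp (μ s) * q s` against `exp (μ s)`.
  obtain ⟨ξ, hξ, h⟩ := exists_ratio_hasDerivAt_eq_ratio_slope
    (fun s => Real.exp (μ * s) * q s) (fun s => Real.exp (μ * s) * μ * F s)
    (sub_lt_self t hr) (hexp_cont.continuousOn.mul hq_cont)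
    (fun x hx => by
      have hx0 : 0 < x := by linarith [hx.1]
      refine ((hexp x).mul ((hq x hx0.le).hasDerivAt (Ici_mem_nhds hx0))).congr_deriv ?_
      ring)
    (fun s => Real.exp (μ * s)) (fun s => Real.exp (μ * s) * μ)
    hexp_cont.continuousOn (fun x _ => hexp x)
  refine ⟨ξ, Set.Ioo_subset_Icc_self hξ, ?_⟩
  have hsplit : Real.exp (μ * (t - r)) = Real.exp (μ * t) * Real.exp (-μ * r) := by
    rw [← Real.exp_add]
    ring_nf
  simp only [hsplit] at h
  have hpos : Real.exp (μ * t) * (Real.exp (μ * ξ) * μ) ≠ 0 := by positivity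
  apply mul_left_cancel₀ hpos
  linear_combination -h
end

section
/- Let 0 ≤ Θ < μ ≤ 1. Then for every θ ∈ [0,Θ] and all real numbers a, b ≥ 0: θ·a + (1−θ)·b ≤ max{ μ·a, (μ(1−Θ)/(μ−Θ))·b }. -/
/-- The elementary convex-combination-to-max inequality: for `0 ≤ Θ < μ ≤ 1`,
`θ ∈ [0,Θ]` and `a, b ≥ 0`, one has
`θ·a + (1-θ)·b ≤ max (μ·a) ((μ(1-Θ)/(μ-Θ))·b)`. -/
theorem convex_combination_le_max (Θ μ : ℝ) (hΘ0 : 0 ≤ Θ) (hΘμ : Θ < μ) (hμ1 : μ ≤ 1)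
    (θ : ℝ) (hθ : θ ∈ Set.Icc 0 Θ) (a b : ℝ) (ha : 0 ≤ a) (hb : 0 ≤ b) :
    θ * a + (1 - θ) * b ≤ max (μ * a) (μ * (1 - Θ) / (μ - Θ) * b) := by
  obtain ⟨hθ0, hθΘ⟩ := hθ
  have hgap : 0 < μ - Θ := sub_pos.2 hΘμ
  have hΘ1 : 0 < 1 - Θ := by linarith
  have hθ1 : 0 ≤ 1 - θ := by linarith
  have hweights : θ * (1 - Θ) + (1 - θ) * (μ - Θ) ≤ μ * (1 - Θ) := by
    nlinarith [mul_nonneg (sub_nonneg.2 hθΘ) (sub_nonneg.2 hμ1)]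
  rcases le_total ((1 - Θ) * b) ((μ - Θ) * a) with hab | hab
  · refine le_max_of_le_left (le_of_mul_le_mul_left ?_ hΘ1)
    linarith [mul_le_mul_of_nonneg_left hab hθ1, mul_le_mul_of_nonneg_right hweights ha]
  · refine le_max_of_le_right ?_
    rw [div_mul_eq_mul_div, le_div_iff₀ hgap]
    linarith [mul_le_mul_of_nonneg_left hab hθ0, mul_le_mul_of_nonneg_right hweights hb]
end

section
/- Consider Cournot oligopoly data. The map F : S → S defined by F(q) := (f_1(q_{−1}),…,f_n(q_{−n})) is continuous, S is a nonempty compact convex subset of ℝ^n, and F has at least one fixed point q* ∈ S; i.e., the Cournot game admits a Nash equilibrium q* ∈ S with q_i* = f_i(q*_{−i}) for all i. -/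
open scoped BigOperators

/-- A point of `[0, Q]` nearest to `m` is the truncation of `m` to `[0, Q]`. -/
lemma eq_min_max_of_forall_sq_le {Q m x : ℝ} (hx : x ∈ Set.Icc 0 Q)
    (h : ∀ t ∈ Set.Icc 0 Q, (x - m) ^ 2 ≤ (t - m) ^ 2) : x = min Q (max 0 m) := by
  obtain ⟨h0, hQ⟩ := hx
  rcases le_total m 0 with hm | hm
  · have := h 0 ⟨le_rfl, h0.trans hQ⟩
    rw [max_eq_left hm, min_eq_right (h0.trans hQ)]
    nlinarith
  rw [max_eq_right hm]
  rcases le_total m Q with hmQ | hmQ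
  · have := h m ⟨hm, hmQ⟩
    rw [min_eq_right hmQ]
    nlinarith
  · have := h Q ⟨h0.trans hQ, le_rfl⟩
    rw [min_eq_left hmQ]
    nlinarith

/-- A potential of the Cournot game with marginal intercepts `A` and curvatures `d`. -/
noncomputable def cournotPotential {n : ℕ} (b : ℝ) (A d q : Fin n → ℝ) : ℝ :=
  ∑ i, (A i * q i - (d i - b) / 2 * q i ^ 2) - b / 2 * (∑ i, q i) ^ 2

lemma continuous_cournotPotential {n : ℕ} (b : ℝ) (A d : Fin n → ℝ) :
    Continuous (cournotPotential b A d) := by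
  unfold cournotPotential
  fun_prop

/-- The effect on the potential of changing a single coordinate. -/
lemma cournotPotential_update_sub {n : ℕ} (b : ℝ) (A d q : Fin n → ℝ) (i : Fin n) (t : ℝ)
    (hd : d i ≠ 0) :
    cournotPotential b A d (Function.update q i t) - cournotPotential b A d q =
      d i / 2 * ((q i - (A i / d i - b / d i * ∑ j ∈ Finset.univ.erase i, q j)) ^ 2 -
        (t - (A i / d i - b / d i * ∑ j ∈ Finset.univ.erase i, q j)) ^ 2) := by
  have key (g : Fin n → ℝ → ℝ) : ∑ j, g j (Function.update q i t j) =
      g i t + ∑ j ∈ Finset.univ.erase i, g j (q j) := by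
    rw [← Finset.add_sum_erase _ _ (Finset.mem_univ i), Function.update_self]
    congr 1
    refine Finset.sum_congr rfl fun j hj => ?_
    rw [Function.update_of_ne (Finset.ne_of_mem_erase hj)]
  unfold cournotPotential
  rw [key fun j x => A j * x - (d j - b) / 2 * x ^ 2, key fun _ x => x,
    ← Finset.add_sum_erase _ (fun j => A j * q j - (d j - b) / 2 * q j ^ 2) (Finset.mem_univ i),
    ← Finset.add_sum_erase _ q (Finset.mem_univ i)]
  field_simp
  ring

/-- Existence of a Nash equilibrium for the Cournot oligopoly game: the best-reply map
`F : S → S` is continuous, `S` is a nonempty compact convex subset of `ℝ^n`, `F` maps `S`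
into itself, and `F` has at least one fixed point `q* ∈ S`. -/
theorem cournot_nash_exists (n : ℕ) (hn : 2 ≤ n) (a b : ℝ) (ha : 0 < a) (hb : 0 < b)
    (Q c K : Fin n → ℝ) (hQ : ∀ i, 0 < Q i) (haQ : ∑ i, Q i ≤ a)
    (hbK : ∀ i, 0 < 2 * b + K i)
    (R : Fin n → ℝ) (hR : ∀ i, R i = b / (2 * b + K i)) :
    Continuous (fun q : Fin n → ℝ => fun i : Fin n =>
      min (Q i) (max 0 ((a * b - c i) / (2 * b + K i) -
        R i * ∑ j ∈ Finset.univ.erase i, q j))) ∧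
    ({q : Fin n → ℝ | ∀ i, q i ∈ Set.Icc 0 (Q i)}).Nonempty ∧
    IsCompact {q : Fin n → ℝ | ∀ i, q i ∈ Set.Icc 0 (Q i)} ∧
    Convex ℝ {q : Fin n → ℝ | ∀ i, q i ∈ Set.Icc 0 (Q i)} ∧
    Set.MapsTo (fun q : Fin n → ℝ => fun i : Fin n =>
        min (Q i) (max 0 ((a * b - c i) / (2 * b + K i) -
          R i * ∑ j ∈ Finset.univ.erase i, q j)))
      {q : Fin n → ℝ | ∀ i, q i ∈ Set.Icc 0 (Q i)}
      {q : Fin n → ℝ | ∀ i, q i ∈ Set.Icc 0 (Q i)} ∧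
    ∃ qstar : Fin n → ℝ, (∀ i, qstar i ∈ Set.Icc 0 (Q i)) ∧
      ∀ i, qstar i = min (Q i) (max 0 ((a * b - c i) / (2 * b + K i) -
        R i * ∑ j ∈ Finset.univ.erase i, qstar j)) := by
  have hS : {q : Fin n → ℝ | ∀ i, q i ∈ Set.Icc 0 (Q i)} =
      Set.univ.pi fun i => Set.Icc 0 (Q i) := by
    ext q
    simp only [Set.mem_ofPred_eq, Set.mem_univ_pi]
  have hne : ({q : Fin n → ℝ | ∀ i, q i ∈ Set.Icc 0 (Q i)}).Nonempty :=
    ⟨0, fun i => ⟨le_rfl, (hQ i).le⟩⟩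
  have hcomp : IsCompact {q : Fin n → ℝ | ∀ i, q i ∈ Set.Icc 0 (Q i)} := by
    rw [hS]
    exact isCompact_univ_pi fun i => isCompact_Icc
  refine ⟨by fun_prop, hne, hcomp, ?_, ?_, ?_⟩
  · rw [hS]
    exact convex_pi fun i _ => convex_Icc 0 (Q i)
  · exact fun q _ i => ⟨le_min (hQ i).le (le_max_left _ _), min_le_left _ _⟩
  · obtain ⟨q, hq, hmax⟩ := hcomp.exists_isMaxOn hne
      (continuous_cournotPotential b (fun i => a * b - c i) fun i => 2 * b + K i).continuousOn
    refine ⟨q, hq, fun i => eq_min_max_of_forall_sq_le (hq i) fun t ht => ?_⟩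
    have hmem : Function.update q i t ∈ {q : Fin n → ℝ | ∀ i, q i ∈ Set.Icc 0 (Q i)} := by
      intro j
      rcases eq_or_ne j i with rfl | hj
      · simpa using ht
      · simpa [hj] using hq j
    have hle := sub_nonpos.mpr (isMaxOn_iff.mp hmax _ hmem)
    rw [cournotPotential_update_sub b _ _ q i t (hbK i).ne'] at hle
    rw [hR i]
    exact sub_nonpos.mp (nonpos_of_mul_nonpos_right hle (half_pos (hbK i)))
end

section
/- Consider Cournot oligopoly data with Nash equilibrium q* ∈ S. Fix i ∈ {1,…,n}, t ≥ 0, 0 < r ≤ T, θ ∈ [0,1], τ ∈ [r,T], and let q : [−T,∞) → S be bounded. Suppose e_j ∈ [0,Q_j] (j ≠ i) satisfy |e_j − q_j*| ≤ ‖q_j − q_j*‖_{[t−T,t−r]}, and suppose q_i(t) = θ·min{Q_i, max{0, q_i(t−τ)}} + (1−θ)·min{Q_i, max{0, (ab−c_i)/(2b+K_i) − R_i·Σ_{j≠i} e_j}}. Then |q_i(t) − q_i*| ≤ θ·‖q_i − q_i*‖_{[t−T,t−r]} + (1−θ)·R_i·Σ_{j≠i} ‖q_j − q_j*‖_{[t−T,t−r]}.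 -/
open scoped BigOperators

theorem abs_min_max_sub_min_max_le (Q x y : ℝ) :
    |min Q (max 0 x) - min Q (max 0 y)| ≤ |x - y| := by
  have hmin := abs_min_sub_min_le_max Q (max 0 x) Q (max 0 y)
  have hmax := abs_max_sub_max_le_max 0 x 0 y
  simp only [sub_self, abs_zero, abs_nonneg, sup_of_le_right] at hmin hmax
  exact hmin.trans hmax

theorem abs_le_sNorm {x : ℝ → ℝ} {α β C s : ℝ} (hx : ∀ u ∈ Set.Icc α β, |x u| ≤ C)
    (hs : s ∈ Set.Icc α β) : |x s| ≤ sNorm x α β := by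
  refine le_csSup ⟨C, ?_⟩ ⟨s, hs, rfl⟩
  rintro _ ⟨u, hu, rfl⟩
  exact hx u hu

/-- Estimate (A.2)/(A.3): one step of the Cournot functional difference equation yields the
convex-combination bound for the deviation from the Nash equilibrium. -/
theorem cournot_one_step_estimate (n : ℕ) (hn : 2 ≤ n) (a b : ℝ) (ha : 0 < a) (hb : 0 < b)
    (Q c K : Fin n → ℝ) (hQ : ∀ i, 0 < Q i) (haQ : ∑ i, Q i ≤ a)
    (hbK : ∀ i, 0 < 2 * b + K i)
    (R : Fin n → ℝ) (hR : ∀ i, R i = b / (2 * b + K i))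
    (qstar : Fin n → ℝ) (hqstarS : ∀ i, qstar i ∈ Set.Icc 0 (Q i))
    (hNash : ∀ i, qstar i = min (Q i) (max 0 ((a * b - c i) / (2 * b + K i) -
      R i * ∑ j ∈ Finset.univ.erase i, qstar j)))
    (i : Fin n) (t : ℝ) (ht : 0 ≤ t) (r T : ℝ) (hr : 0 < r) (hrT : r ≤ T)
    (θ : ℝ) (hθ : θ ∈ Set.Icc (0 : ℝ) 1) (τ : ℝ) (hτ : τ ∈ Set.Icc r T)
    (q : ℝ → Fin n → ℝ) (hq : ∀ s, -T ≤ s → ∀ j, q s j ∈ Set.Icc 0 (Q j))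
    (e : Fin n → ℝ)
    (he_mem : ∀ j, j ≠ i → e j ∈ Set.Icc 0 (Q j))
    (he : ∀ j, j ≠ i → |e j - qstar j| ≤ sNorm (fun s => q s j - qstar j) (t - T) (t - r))
    (heq : q t i = θ * min (Q i) (max 0 (q (t - τ) i)) +
      (1 - θ) * min (Q i) (max 0 ((a * b - c i) / (2 * b + K i) -
        R i * ∑ j ∈ Finset.univ.erase i, e j))) :
    |q t i - qstar i| ≤ θ * sNorm (fun s => q s i - qstar i) (t - T) (t - r) +
      (1 - θ) * R i * ∑ j ∈ Finset.univ.erase i,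
        sNorm (fun s => q s j - qstar j) (t - T) (t - r) := by
  obtain ⟨hθ0, hθ1⟩ := hθ
  obtain ⟨hrτ, hτT⟩ := hτ
  have hRi : 0 ≤ R i := by
    rw [hR]
    exact (div_pos hb (hbK i)).le
  have hclamp : min (Q i) (max 0 (qstar i)) = qstar i := by
    rw [max_eq_right (hqstarS i).1, min_eq_right (hqstarS i).2]
  have hdelay : |min (Q i) (max 0 (q (t - τ) i)) - qstar i| ≤
      sNorm (fun s => q s i - qstar i) (t - T) (t - r) := by
    have hle := abs_min_max_sub_min_max_le (Q i) (q (t - τ) i) (qstar i)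
    rw [hclamp] at hle
    refine hle.trans (abs_le_sNorm (x := fun s => q s i - qstar i) (C := Q i) ?_
      ⟨by linarith, by linarith⟩)
    intro u hu
    have hqu := hq u (by linarith [hu.1]) i
    have hqs := hqstarS i
    exact abs_le.2 ⟨by linarith [hqu.1, hqs.2], by linarith [hqu.2, hqs.1]⟩
  have hreply : |min (Q i) (max 0 ((a * b - c i) / (2 * b + K i) -
      R i * ∑ j ∈ Finset.univ.erase i, e j)) - qstar i| ≤
      R i * ∑ j ∈ Finset.univ.erase i,
        sNorm (fun s => q s j - qstar j) (t - T) (t - r) := by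
    conv_lhs => rw [hNash i]
    refine (abs_min_max_sub_min_max_le _ _ _).trans ?_
    rw [sub_sub_sub_cancel_left, ← mul_sub, abs_mul, abs_of_nonneg hRi, abs_sub_comm,
      ← Finset.sum_sub_distrib]
    refine mul_le_mul_of_nonneg_left ((Finset.abs_sum_le_sum_abs _ _).trans ?_) hRi
    exact Finset.sum_le_sum fun j hj => he j (Finset.ne_of_mem_erase hj)
  set A := min (Q i) (max 0 (q (t - τ) i))
  set B := min (Q i) (max 0 ((a * b - c i) / (2 * b + K i) -
    R i * ∑ j ∈ Finset.univ.erase i, e j))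
  calc |q t i - qstar i| = |θ * (A - qstar i) + (1 - θ) * (B - qstar i)| := by
        rw [heq]
        ring_nf
    _ ≤ θ * |A - qstar i| + (1 - θ) * |B - qstar i| := by
        refine (abs_add_le _ _).trans_eq ?_
        rw [abs_mul, abs_mul, abs_of_nonneg hθ0, abs_of_nonneg (sub_nonneg.2 hθ1)]
    _ ≤ _ := by
        rw [mul_assoc]
        exact add_le_add (mul_le_mul_of_nonneg_left hdelay hθ0)
          (mul_le_mul_of_nonneg_left hreply (sub_nonneg.2 hθ1))
end

section
/- Let n ≥ 2 and let γ_{i,j} : [0,∞) → [0,∞) (i ≠ j, i,j = 1,…,n) be functions of class N satisfying the cyclic small-gain conditions: for each p = 2,…,n and all pairwise distinct indices i_1,…,i_p ∈ {1,…,n}, (γ_{i_1,i_2}∘γ_{i_2,i_3}∘⋯∘γ_{i_p,i_1})(s) < s for all s > 0. If non-negative real numbers y_1,…,y_n satisfy y_i ≤ max_{j≠i} γ_{i,j}(y_j) for every i = 1,…,n, then y_i = 0 for every i. -/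
theorem exists_ne_le_of_le_maxNe {n : ℕ} (hn : 2 ≤ n) {i : Fin n} {g : Fin n → ℝ} {a : ℝ}
    (h : a ≤ maxNe i g) : ∃ j, j ≠ i ∧ a ≤ g j := by
  have : Nontrivial (Fin n) := Fin.nontrivial_iff_two_le.mpr hn
  have hfin : {y | ∃ j, j ≠ i ∧ y = g j}.Finite :=
    (Set.finite_range g).subset (by rintro _ ⟨j, -, rfl⟩; exact ⟨j, rfl⟩)
  obtain ⟨k, hk⟩ := exists_ne i
  have hne : {y | ∃ j, j ≠ i ∧ y = g j}.Nonempty := ⟨g k, k, hk, rfl⟩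
  obtain ⟨j, hj, hjs⟩ := hne.csSup_mem hfin
  exact ⟨j, hj, h.trans_eq hjs⟩

/-- A chain of inequalities `z k ≤ F k (z (k + 1))` telescopes along the composition of the `F k`. -/
theorem le_foldr_comp_ofFn {p : ℕ} (F : Fin p → ℝ → ℝ) (z : ℕ → ℝ) (hz : ∀ k, 0 ≤ z k)
    (hF : ∀ k, MonotoneOn (F k) (Set.Ici 0)) (h : ∀ k : Fin p, z k ≤ F k (z (k + 1))) :
    z 0 ≤ (List.ofFn F).foldr (· ∘ ·) id (z p) := by
  induction p generalizing z with
  | zero => simp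
  | succ p ih =>
    have hrest := ih (fun k => F k.succ) (fun k => z (k + 1)) (fun k => hz _) (fun k => hF _)
      (fun k => by simpa using h k.succ)
    rw [List.ofFn_succ, List.foldr_cons]
    exact (h 0).trans (hF 0 (hz _) ((hz _).trans hrest) hrest)

theorem exists_iterate_mem_periodicPts {α : Type*} [Finite α] (f : α → α) (a : α) :
    ∃ m, f^[m] a ∈ Function.periodicPts f := by
  obtain ⟨m, k, hmk, h⟩ := Set.finite_univ.exists_lt_map_eq_of_forall_mem
    (f := fun m => f^[m] a) (fun _ => Set.mem_univ _)
  refine ⟨m, Function.mk_mem_periodicPts (Nat.sub_pos_of_lt hmk) ?_⟩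
  rw [Function.IsPeriodicPt, Function.IsFixedPt, ← Function.iterate_add_apply,
    Nat.sub_add_cancel hmk.le]
  exact h.symm

/-- The algebraic core of the small-gain uniqueness arguments: under the cyclic
small-gain conditions, any non-negative solution of the max-gain inequalities
`y_i ≤ max_{j≠i} γ_{i,j}(y_j)` is identically zero. -/
theorem smallgain_algebraic_core (n : ℕ) (hn : 2 ≤ n)
    (γ : Fin n → Fin n → ℝ → ℝ) (hγ : ∀ i j, i ≠ j → ClassN (γ i j))
    (hSG : ∀ p : ℕ, 2 ≤ p → p ≤ n → ∀ ι : Fin p → Fin n, Function.Injective ι →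
      ∀ s : ℝ, 0 < s → cyclicComp γ ι s < s)
    (y : Fin n → ℝ) (hy0 : ∀ i, 0 ≤ y i)
    (hy : ∀ i, y i ≤ maxNe i (fun j => γ i j (y j))) :
    ∀ i, y i = 0 := by
  choose f hfne hf using fun i => exists_ne_le_of_le_maxNe hn (hy i)
  have hpos_step : ∀ i, 0 < y i → 0 < y (f i) := fun i hi => by
    refine (hy0 _).lt_of_ne fun h0 => ?_
    have hle := hf i
    rw [← h0, (hγ i (f i) (hfne i).symm).2.2.1] at hle
    exact hle.not_gt hi
  intro i
  by_contra hi
  have hpos : ∀ m, 0 < y (f^[m] i) := fun m => by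
    induction m with
    | zero => exact (hy0 i).lt_of_ne' hi
    | succ m ih => rw [Function.iterate_succ_apply']; exact hpos_step _ ih
  obtain ⟨m, hm⟩ := exists_iterate_mem_periodicPts f i
  have hx := hpos m
  generalize f^[m] i = x at hm hx
  set p := Function.minimalPeriod f x with hp
  have hp0 : 0 < p := Function.minimalPeriod_pos_of_mem_periodicPts hm
  have hp1 : p ≠ 1 := fun h => hfne x (Function.minimalPeriod_eq_one_iff_isFixedPt.mp h)
  let ι : Fin p → Fin n := fun j => f^[j] x
  have hι : Function.Injective ι := fun a b hab =>
    Fin.ext (Function.iterate_injOn_Iio_minimalPeriod a.2 b.2 hab)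
  have hpn : p ≤ n := by simpa using Fintype.card_le_of_injective ι hι
  have hnext : ∀ j : Fin p, ι ⟨(j.1 + 1) % p, Nat.mod_lt _ j.pos⟩ = f (ι j) := fun j => by
    simp only [ι, hp, Function.iterate_mod_minimalPeriod_eq, Function.iterate_succ_apply']
  have hle : y x ≤ cyclicComp γ ι (y x) := by
    have key := le_foldr_comp_ofFn (fun j : Fin p => γ (ι j) (f (ι j))) (fun k => y (f^[k] x))
      (fun k => hy0 _) (fun k => (hγ _ _ (hfne _).symm).2.1)
      (fun k => by simpa only [Function.iterate_succ_apply'] using hf (ι k))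
    have hfix : f^[p] x = x := Function.iterate_minimalPeriod
    simpa only [cyclicComp, hnext, hfix, Function.iterate_zero_apply] using key
  exact hle.not_gt (hSG p (by omega) hpn ι hι _ hx)
end
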